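/- Suppose G : ℝ^k → ℝ^d is twice continuously differentiable, satisfies ‖G(z) − G(z')‖ ≥ R‖z − z'‖ for all z, z' ∈ ℝ^k (R > 0), and for every coordinate i and every z, the Hessian of G_i satisfies |∇²G_i(z)[v, v]| ≤ M‖v‖² for all v ∈ ℝ^k. Fix x ∈ ℝ^d and define h : ℝ^k → ℝ by h(z) = ‖G(z) − x‖². Then for every z and every v ∈ ℝ^k, the Hessian of h satisfies ∇²h(z)[v, v] ≥ 2(R²/d)‖v‖² − 2√d · M · ‖G(z) − x‖ · ‖v‖². -/

import Mathlib

open scoped RealInnerProductSpace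

/-- The second derivative of `z ↦ ‖G z - x‖ ^ 2` along the diagonal. -/
lemma iteratedFDeriv_two_norm_sub_sq_apply {E F : Type*}
    [NormedAddCommGroup E] [NormedSpace ℝ E] [NormedAddCommGroup F] [InnerProductSpace ℝ F]
    {G : E → F} (hG : ContDiff ℝ 2 G) (x : F) (z v : E) :
    iteratedFDeriv ℝ 2 (fun z => ‖G z - x‖ ^ 2) z ![v, v]
      = 2 * ‖fderiv ℝ G z v‖ ^ 2 + 2 * ⟪G z - x, iteratedFDeriv ℝ 2 G z ![v, v]⟫ := by
  have hd : Differentiable ℝ G := hG.differentiable (by norm_num)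
  have hd' : Differentiable ℝ (fderiv ℝ G) :=
    (hG.fderiv_right (m := 1) (by norm_num)).differentiable (by norm_num)
  have hh : ContDiff ℝ 2 fun z => ‖G z - x‖ ^ 2 := (hG.sub contDiff_const).norm_sq ℝ
  have hh' : Differentiable ℝ (fderiv ℝ fun z => ‖G z - x‖ ^ 2) :=
    (hh.fderiv_right (m := 1) (by norm_num)).differentiable (by norm_num)
  have hfirst : (fun y => fderiv ℝ (fun z => ‖G z - x‖ ^ 2) y v)
      = fun y => 2 * ⟪G y - x, fderiv ℝ G y v⟫ := by
    funext y
    rw [((hd y).hasFDerivAt.sub_const x).norm_sq.fderiv]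
    simp [inner_sub_left]
  have hsecond := (((hd z).hasFDerivAt.sub_const x).inner ℝ
    ((hd' z).hasFDerivAt.clm_apply (hasFDerivAt_const v z))).const_mul 2
  have hleft := (hh' z).hasFDerivAt.clm_apply (hasFDerivAt_const v z)
  rw [hfirst] at hleft
  have key := congrArg (fun L => L v) (hleft.unique hsecond)
  simp only [iteratedFDeriv_two_apply, Matrix.cons_val_zero, Matrix.cons_val_one]
  simp at key
  rw [key]
  ring

/-- A lower bound on the expansion of a map is inherited by its derivative. -/
lemma HasFDerivAt.le_norm_apply_of_le_norm_sub {E F : Type*}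
    [NormedAddCommGroup E] [NormedSpace ℝ E] [NormedAddCommGroup F] [NormedSpace ℝ F]
    {G : E → F} {G' : E →L[ℝ] F} {z : E} (hG' : HasFDerivAt G G' z) {R : ℝ}
    (hG : ∀ z z' : E, R * ‖z - z'‖ ≤ ‖G z - G z'‖) (v : E) :
    R * ‖v‖ ≤ ‖G' v‖ := by
  have hlim := (hG'.hasLineDerivAt v).tendsto_slope_zero.norm
  refine ge_of_tendsto hlim ?_
  filter_upwards [self_mem_nhdsWithin] with t ht
  have ht : 0 < |t| := abs_pos.mpr ht
  have h := hG (z + t • v) z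
  simp only [add_sub_cancel_left, norm_smul, Real.norm_eq_abs] at h
  simp only [norm_smul, norm_inv, Real.norm_eq_abs]
  rw [inv_mul_eq_div, le_div_iff₀ ht]
  linarith

lemma EuclideanSpace.norm_le_sqrt_card_mul {ι : Type*} [Fintype ι] {w : EuclideanSpace ℝ ι}
    {C : ℝ} (hC : 0 ≤ C) (hw : ∀ i, |w i| ≤ C) : ‖w‖ ≤ √(Fintype.card ι) * C := by
  rw [EuclideanSpace.norm_eq]
  refine Real.sqrt_le_iff.mpr ⟨by positivity, ?_⟩
  rw [mul_pow, Real.sq_sqrt (Nat.cast_nonneg _)]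
  calc ∑ i, ‖w i‖ ^ 2 ≤ ∑ _i : ι, C ^ 2 :=
        Finset.sum_le_sum fun i _ => pow_le_pow_left₀ (norm_nonneg _) (hw i) 2
    _ = Fintype.card ι * C ^ 2 := by simp

theorem hessian_reconstruction_lower_bound
    (k d : ℕ)
    (G : EuclideanSpace ℝ (Fin k) → EuclideanSpace ℝ (Fin d))
    (hGsmooth : ContDiff ℝ 2 G)
    (R : ℝ) (hR : 0 < R)
    (hG : ∀ z z' : EuclideanSpace ℝ (Fin k), ‖G z - G z'‖ ≥ R * ‖z - z'‖)
    (M : ℝ)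
    (hHess : ∀ (i : Fin d) (z v : EuclideanSpace ℝ (Fin k)),
      |iteratedFDeriv ℝ 2 (fun z => G z i) z ![v, v]| ≤ M * ‖v‖ ^ 2)
    (x : EuclideanSpace ℝ (Fin d)) :
    ∀ (z v : EuclideanSpace ℝ (Fin k)),
      iteratedFDeriv ℝ 2 (fun z => ‖G z - x‖ ^ 2) z ![v, v]
        ≥ 2 * (R ^ 2 / d) * ‖v‖ ^ 2
          - 2 * Real.sqrt d * M * ‖G z - x‖ * ‖v‖ ^ 2 := by
  intro z v
  rw [iteratedFDeriv_two_norm_sub_sq_apply hGsmooth x z v]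
  set w := iteratedFDeriv ℝ 2 G z ![v, v]
  have hcoord : ∀ i, |w i| ≤ M * ‖v‖ ^ 2 := fun i => by
    have h := (EuclideanSpace.proj i : EuclideanSpace ℝ (Fin d) →L[ℝ] ℝ).iteratedFDeriv_comp_left
      hGsmooth.contDiffAt (x := z) (i := 2) le_rfl
    have h' := congrArg (fun L => L ![v, v]) h
    have hi := hHess i z v
    exact (congrArg abs h').symm.trans_le hi
  rcases Nat.eq_zero_or_pos d with rfl | hd
  · have hsub : ∀ u : EuclideanSpace ℝ (Fin 0), u = 0 := fun u => Subsingleton.elim _ _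
    simp [hsub (G z - x), hsub (fderiv ℝ G z v)]
  have hC : 0 ≤ M * ‖v‖ ^ 2 := (abs_nonneg _).trans (hcoord ⟨0, hd⟩)
  have hw : ‖w‖ ≤ √d * (M * ‖v‖ ^ 2) := by
    simpa using EuclideanSpace.norm_le_sqrt_card_mul hC hcoord
  have hinner : -(‖G z - x‖ * (√d * (M * ‖v‖ ^ 2))) ≤ ⟪G z - x, w⟫ :=
    (neg_le_neg (mul_le_mul_of_nonneg_left hw (norm_nonneg _))).trans
      (neg_le_of_abs_le (abs_real_inner_le_norm _ _))
  have hderiv : R * ‖v‖ ≤ ‖fderiv ℝ G z v‖ :=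
    (hGsmooth.differentiable (by norm_num) z).hasFDerivAt.le_norm_apply_of_le_norm_sub hG v
  have hsq : R ^ 2 * ‖v‖ ^ 2 ≤ ‖fderiv ℝ G z v‖ ^ 2 := by
    rw [← mul_pow]
    exact pow_le_pow_left₀ (by positivity) hderiv 2
  have hdiv : R ^ 2 / d * ‖v‖ ^ 2 ≤ R ^ 2 * ‖v‖ ^ 2 :=
    mul_le_mul_of_nonneg_right
      (div_le_self (sq_nonneg R) (Nat.one_le_cast.mpr hd)) (sq_nonneg _)
  linarith
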